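/- (Multi-time equilibration bound, Theorem 1.) Let ϱ be a Hermitian d×d complex matrix with equilibrium ϖ = 𝒟(ϱ), let 𝒜₀, …, 𝒜_k be linear maps on M_d, and let G^{(0)}, …, G^{(k)} : ι×ι → ℂ be coefficient families with G^{(j)}_{nn} = 1 for all n, j, with associated partial dephasings 𝒢_j = 𝒢_{G^{(j)}}. Define the intermediate states ϱ_ℓ = 𝒢_ℓ ∘ 𝒜_{ℓ−1} ∘ 𝒢_{ℓ−1} ∘ ⋯ ∘ 𝒜₀ ∘ 𝒢₀ (ϱ) and ϖ_ℓ = 𝒟 ∘ 𝒜_{ℓ−1} ∘ ⋯ ∘ 𝒜₀ ∘ 𝒟 (ϱ), write 𝒜_{b:a} = 𝒜_b ∘ ⋯ ∘ 𝒜_a and 𝒢_{k:ℓ} = 𝒢_k ∘ ⋯ ∘ 𝒢_ℓ, and set 𝔖_{b:a} = ∏_{j=a}^{b} max_{n≠m} |G^{(j)}_{nm}|. Then |tr[((𝒜_k∘𝒢_k) ∘ ⋯ ∘ (𝒜₀∘𝒢₀))(ϱ)] − tr[((𝒜_k∘𝒟) ∘ ⋯ ∘ (𝒜₀∘𝒟))(ϱ)]|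 ≤ ν(𝒜_{k:0}) · 𝔖_{k:0} · ‖ϱ − ϖ‖₂ + Σ_{ℓ=0}^{k−1} ν(𝒜_{k:ℓ+1}) · ( ‖[𝒢_{k:ℓ+1} − 𝒟, 𝒜_ℓ](ϱ_ℓ)‖₂ + ‖[𝒟, 𝒜_ℓ](ϱ_ℓ − ϖ_ℓ)‖₂ ). -/

import Mathlib

open Matrix BigOperators

/-- The Frobenius (Hilbert–Schmidt) norm `‖X‖₂ = √(tr(XᴴX))`. -/
noncomputable def frob {d : ℕ} (X : Matrix (Fin d) (Fin d) ℂ) : ℝ :=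
  Real.sqrt ((Xᴴ * X).trace.re)

/-- The dephasing map `𝒟(X) = Σ_n P_n X P_n`. -/
noncomputable def deph {d : ℕ} {ι : Type*} [Fintype ι]
    (P : ι → Matrix (Fin d) (Fin d) ℂ) (X : Matrix (Fin d) (Fin d) ℂ) :
    Matrix (Fin d) (Fin d) ℂ :=
  ∑ n, P n * X * P n

/-- The partial dephasing map `𝒢_G(X) = Σ_{n,m} G_{nm} P_n X P_m`. -/
noncomputable def pdeph {d : ℕ} {ι : Type*} [Fintype ι]
    (P : ι → Matrix (Fin d) (Fin d) ℂ) (G : ι → ι → ℂ)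
    (X : Matrix (Fin d) (Fin d) ℂ) : Matrix (Fin d) (Fin d) ℂ :=
  ∑ n, ∑ m, G n m • (P n * X * P m)

/-- `max_{n≠m} |G_{nm}|`, the maximum modulus of the off-diagonal coefficients. -/
noncomputable def maxOffDiag {ι : Type*} [Fintype ι] [DecidableEq ι] [Nontrivial ι]
    (G : ι → ι → ℂ) : ℝ :=
  Finset.univ.offDiag.sup'
    (by
      obtain ⟨a, b, hab⟩ := exists_pair_ne ι
      exact ⟨(a, b), Finset.mem_offDiag.mpr ⟨Finset.mem_univ _, Finset.mem_univ _, hab⟩⟩)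
    (fun p => ‖G p.1 p.2‖)

/-- `chainApply f n = f (n−1) ∘ ⋯ ∘ f 1 ∘ f 0` (the identity when `n = 0`). -/
def chainApply {M : Type*} (f : ℕ → M → M) : ℕ → M → M
  | 0, x => x
  | n + 1, x => f n (chainApply f n x)

/-- `chainFun f a n = f (a+n−1) ∘ ⋯ ∘ f (a+1) ∘ f a` (the identity when `n = 0`). -/
def chainFun {M : Type*} (f : ℕ → M → M) (a : ℕ) : ℕ → M → M
  | 0, x => x
  | n + 1, x => f (a + n) (chainFun f a n x)

/-- `chainEnd f a n = f (a+n−1) ∘ ⋯ ∘ f (a+1) ∘ f a` in the endomorphism ring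
(the identity map when `n = 0`). -/
noncomputable def chainEnd {d : ℕ}
    (f : ℕ → Module.End ℂ (Matrix (Fin d) (Fin d) ℂ)) (a n : ℕ) :
    Module.End ℂ (Matrix (Fin d) (Fin d) ℂ) :=
  (((List.range' a n).reverse).map f).prod

/-- The trace-functional norm `ν(𝒳) = sup_{‖σ‖₂=1} |tr(𝒳(σ))|` induced by the
Frobenius norm. -/
noncomputable def nuFrob {d : ℕ} (𝒳 : Module.End ℂ (Matrix (Fin d) (Fin d) ℂ)) : ℝ :=
  ⨆ σ : {σ : Matrix (Fin d) (Fin d) ℂ // frob σ = 1}, ‖(𝒳 σ.1).trace‖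

lemma chainFun_succ' {M : Type*} (f : ℕ → M → M) (a n : ℕ) (x : M) :
    chainFun f a (n + 1) x = chainFun f (a + 1) n (f a x) := by
  induction n with
  | zero => rfl
  | succ n ih =>
    change f (a + (n + 1)) (chainFun f a (n + 1) x) = f (a + 1 + n) _
    rw [ih, Nat.add_right_comm a 1 n, Nat.add_assoc]

lemma chainEnd_succ {d : ℕ} (f : ℕ → Module.End ℂ (Matrix (Fin d) (Fin d) ℂ)) (a n : ℕ)
    (X : Matrix (Fin d) (Fin d) ℂ) :
    chainEnd f a (n + 1) X = chainEnd f (a + 1) n (f a X) := by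
  simp [chainEnd, List.range'_succ]

lemma chainEnd_eq_add_sum {d : ℕ} (A : ℕ → Module.End ℂ (Matrix (Fin d) (Fin d) ℂ))
    (T C : ℕ → Matrix (Fin d) (Fin d) ℂ) (k : ℕ)
    (h : ∀ l < k, T (l + 1) = A l (T l) + C l) (n : ℕ) (hn : n ≤ k) :
    chainEnd A n (k + 1 - n) (T n) = chainEnd A 0 (k + 1) (T 0) +
      ∑ i ∈ Finset.range n, chainEnd A (i + 1) (k - i) (C i) := by
  induction n with
  | zero => simp
  | succ n ih =>
    rw [Finset.sum_range_succ, ← add_assoc, ← ih (by omega), h n (by omega), map_add,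
      show k + 1 - n = (k - n) + 1 by omega, chainEnd_succ,
      show k + 1 - (n + 1) = k - n by omega]

lemma trace_conjTranspose_mul_self_re {d : ℕ} (X : Matrix (Fin d) (Fin d) ℂ) :
    (Xᴴ * X).trace.re = ∑ i, ∑ j, ‖X i j‖ ^ 2 := by
  rw [Finset.sum_comm]
  simp [Matrix.trace, Matrix.mul_apply, ← Complex.normSq_eq_norm_sq, Complex.normSq_apply]

lemma frob_nonneg {d : ℕ} (X : Matrix (Fin d) (Fin d) ℂ) : 0 ≤ frob X :=
  Real.sqrt_nonneg _

lemma frob_sq {d : ℕ} (X : Matrix (Fin d) (Fin d) ℂ) :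
    frob X ^ 2 = (Xᴴ * X).trace.re := by
  refine Real.sq_sqrt ?_
  rw [trace_conjTranspose_mul_self_re]
  positivity

lemma norm_apply_le_frob {d : ℕ} (X : Matrix (Fin d) (Fin d) ℂ) (i j : Fin d) :
    ‖X i j‖ ≤ frob X := by
  refine le_of_sq_le_sq ?_ (frob_nonneg X)
  rw [frob_sq, trace_conjTranspose_mul_self_re]
  calc ‖X i j‖ ^ 2 ≤ ∑ j', ‖X i j'‖ ^ 2 :=
        Finset.single_le_sum (f := fun j' => ‖X i j'‖ ^ 2) (fun _ _ => by positivity)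
          (Finset.mem_univ j)
    _ ≤ _ := Finset.single_le_sum (f := fun i' => ∑ j', ‖X i' j'‖ ^ 2)
          (fun _ _ => by positivity) (Finset.mem_univ i)

lemma frob_smul {d : ℕ} (c : ℂ) (X : Matrix (Fin d) (Fin d) ℂ) :
    frob (c • X) = ‖c‖ * frob X := by
  rw [← sq_eq_sq₀ (frob_nonneg _) (mul_nonneg (norm_nonneg _) (frob_nonneg _)), mul_pow,
    frob_sq, frob_sq, trace_conjTranspose_mul_self_re, trace_conjTranspose_mul_self_re]
  simp [mul_pow, Finset.mul_sum]

lemma eq_zero_of_frob_eq_zero {d : ℕ} {X : Matrix (Fin d) (Fin d) ℂ} (h : frob X = 0) :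
    X = 0 := by
  ext i j
  simpa [h] using norm_apply_le_frob X i j

lemma norm_trace_le_mul_frob {d : ℕ} (F : Module.End ℂ (Matrix (Fin d) (Fin d) ℂ))
    (X : Matrix (Fin d) (Fin d) ℂ) :
    ‖(F X).trace‖ ≤ (∑ i, ∑ j, ‖(F (Matrix.single i j 1)).trace‖) * frob X := by
  have hX : F X = ∑ i, ∑ j, X i j • F (Matrix.single i j 1) := by
    conv_lhs => rw [Matrix.matrix_eq_sum_single X]
    simp only [map_sum, ← map_smul, Matrix.smul_single, smul_eq_mul, mul_one]
  rw [hX, Finset.sum_mul]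
  simp only [Matrix.trace_sum, Matrix.trace_smul]
  refine norm_sum_le_of_le _ fun i _ => ?_
  rw [Finset.sum_mul]
  refine norm_sum_le_of_le _ fun j _ => ?_
  rw [norm_smul, mul_comm]
  exact mul_le_mul_of_nonneg_left (norm_apply_le_frob X i j) (norm_nonneg _)

lemma norm_trace_le_nuFrob_mul_frob {d : ℕ} (F : Module.End ℂ (Matrix (Fin d) (Fin d) ℂ))
    (X : Matrix (Fin d) (Fin d) ℂ) : ‖(F X).trace‖ ≤ nuFrob F * frob X := by
  rcases (frob_nonneg X).eq_or_lt with h | h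
  · rw [← h, eq_zero_of_frob_eq_zero h.symm]
    simp
  have hbdd : BddAbove (Set.range fun σ : {σ : Matrix (Fin d) (Fin d) ℂ // frob σ = 1} =>
      ‖(F σ.1).trace‖) := by
    refine ⟨∑ i, ∑ j, ‖(F (Matrix.single i j 1)).trace‖, ?_⟩
    rintro _ ⟨σ, rfl⟩
    simpa [σ.2] using norm_trace_le_mul_frob F σ.1
  have hunit : frob (((frob X)⁻¹ : ℂ) • X) = 1 := by
    rw [frob_smul, norm_inv, Complex.norm_real, Real.norm_of_nonneg h.le,
      inv_mul_cancel₀ h.ne']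
  have hle := le_ciSup hbdd ⟨_, hunit⟩
  rw [map_smul, Matrix.trace_smul, norm_smul, norm_inv, Complex.norm_real,
    Real.norm_of_nonneg h.le, inv_mul_eq_div, div_le_iff₀ h] at hle
  exact hle

lemma nuFrob_nonneg {d : ℕ} (F : Module.End ℂ (Matrix (Fin d) (Fin d) ℂ)) : 0 ≤ nuFrob F :=
  Real.iSup_nonneg fun _ => norm_nonneg _

section Dephasing

variable {d : ℕ} {ι : Type*} [Fintype ι] {P : ι → Matrix (Fin d) (Fin d) ℂ}

lemma mul_pdeph_mul (hOrth : ∀ n m, n ≠ m → P n * P m = 0) (hIdem : ∀ n, P n * P n = P n)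
    (G : ι → ι → ℂ) (X : Matrix (Fin d) (Fin d) ℂ) (n m : ι) :
    P n * pdeph P G X * P m = G n m • (P n * X * P m) := by
  classical
  have hP : ∀ a b, P a * P b = if a = b then P a else 0 := fun a b => by
    split_ifs with h
    · rw [← h, hIdem]
    · exact hOrth a b h
  have hterm : ∀ a b, P n * (P a * X * P b) * P m =
      if b = m then (if n = a then P n * X * P m else 0) else 0 := fun a b => by
    rw [show P n * (P a * X * P b) * P m = (P n * P a) * X * (P b * P m) by
      simp only [mul_assoc], hP, hP]
    split_ifs <;> simp_all
  simp [pdeph, Finset.mul_sum, Finset.sum_mul, hterm]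

lemma deph_eq_pdeph [DecidableEq ι] (X : Matrix (Fin d) (Fin d) ℂ) :
    deph P X = pdeph P (fun n m => if n = m then 1 else 0) X := by
  simp [deph, pdeph]

lemma mul_deph_mul [DecidableEq ι] (hOrth : ∀ n m, n ≠ m → P n * P m = 0)
    (hIdem : ∀ n, P n * P n = P n) (X : Matrix (Fin d) (Fin d) ℂ) (n m : ι) :
    P n * deph P X * P m = if n = m then P n * X * P m else 0 := by
  rw [deph_eq_pdeph, mul_pdeph_mul hOrth hIdem, ite_smul, one_smul, zero_smul]

lemma deph_deph (hOrth : ∀ n m, n ≠ m → P n * P m = 0) (hIdem : ∀ n, P n * P n = P n)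
    (X : Matrix (Fin d) (Fin d) ℂ) : deph P (deph P X) = deph P X := by
  classical
  refine Finset.sum_congr rfl fun n _ => ?_
  rw [mul_deph_mul hOrth hIdem, if_pos rfl]

lemma deph_sub (X Y : Matrix (Fin d) (Fin d) ℂ) : deph P (X - Y) = deph P X - deph P Y := by
  simp [deph, mul_sub, sub_mul]

lemma mul_chainFun_pdeph_mul (hOrth : ∀ n m, n ≠ m → P n * P m = 0)
    (hIdem : ∀ n, P n * P n = P n) (G : ℕ → ι → ι → ℂ) (X : Matrix (Fin d) (Fin d) ℂ)
    (N : ℕ) (n m : ι) :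
    P n * chainFun (fun j => pdeph P (G j)) 0 N X * P m =
      (∏ j ∈ Finset.range N, G j n m) • (P n * X * P m) := by
  induction N with
  | zero => simp [chainFun]
  | succ N ih =>
    rw [chainFun, mul_pdeph_mul hOrth hIdem, ih, smul_smul, Finset.prod_range_succ, mul_comm,
      Nat.zero_add]

lemma frob_sq_eq_sum (hHerm : ∀ n, (P n)ᴴ = P n) (hIdem : ∀ n, P n * P n = P n)
    (hSum : ∑ n, P n = 1) (X : Matrix (Fin d) (Fin d) ℂ) :
    frob X ^ 2 = ∑ n, ∑ m, frob (P n * X * P m) ^ 2 := by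
  have hterm : ∀ n m, ((P n * X * P m)ᴴ * (P n * X * P m)).trace =
      (Xᴴ * P n * X * P m).trace := fun n m => by
    simp only [conjTranspose_mul, hHerm]
    rw [show P m * (Xᴴ * P n) * (P n * X * P m) = P m * (Xᴴ * (P n * P n) * X * P m) by
      simp only [mul_assoc], hIdem, trace_mul_comm, mul_assoc _ (P m), hIdem]
  simp only [frob_sq, hterm, ← Complex.re_sum, ← trace_sum, ← Finset.mul_sum, hSum, mul_one,
    ← Finset.sum_mul]

variable [DecidableEq ι] [Nontrivial ι]

lemma norm_le_maxOffDiag (G : ι → ι → ℂ) {n m : ι} (h : n ≠ m) : ‖G n m‖ ≤ maxOffDiag G :=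
  Finset.le_sup' (b := (n, m)) (fun p : ι × ι => ‖G p.1 p.2‖)
    (Finset.mem_offDiag.mpr ⟨Finset.mem_univ n, Finset.mem_univ m, h⟩)

lemma maxOffDiag_nonneg (G : ι → ι → ℂ) : 0 ≤ maxOffDiag G := by
  obtain ⟨a, b, hab⟩ := exists_pair_ne ι
  exact (norm_nonneg _).trans (norm_le_maxOffDiag G hab)

/-- A composition of partial dephasings contracts the distance to equilibrium by the product of
the maximal off-diagonal coefficients. -/
lemma frob_chainFun_pdeph_sub_deph_le (hHerm : ∀ n, (P n)ᴴ = P n)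
    (hOrth : ∀ n m, n ≠ m → P n * P m = 0) (hIdem : ∀ n, P n * P n = P n)
    (hSum : ∑ n, P n = 1) (G : ℕ → ι → ι → ℂ) (N : ℕ)
    (hG : ∀ j < N, ∀ n, G j n n = 1) (X : Matrix (Fin d) (Fin d) ℂ) :
    frob (chainFun (fun j => pdeph P (G j)) 0 N X - deph P X) ≤
      (∏ j ∈ Finset.range N, maxOffDiag (G j)) * frob (X - deph P X) := by
  have hM : 0 ≤ ∏ j ∈ Finset.range N, maxOffDiag (G j) :=
    Finset.prod_nonneg fun j _ => maxOffDiag_nonneg (G j)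
  refine le_of_sq_le_sq ?_ (mul_nonneg hM (frob_nonneg _))
  rw [mul_pow, frob_sq_eq_sum hHerm hIdem hSum, frob_sq_eq_sum hHerm hIdem hSum (X - _),
    Finset.mul_sum]
  refine Finset.sum_le_sum fun n _ => ?_
  rw [Finset.mul_sum]
  refine Finset.sum_le_sum fun m _ => ?_
  simp only [mul_sub, sub_mul, mul_chainFun_pdeph_mul hOrth hIdem, mul_deph_mul hOrth hIdem]
  rcases eq_or_ne n m with rfl | h
  · rw [Finset.prod_eq_one fun j hj => hG j (Finset.mem_range.mp hj) n]
    simp [frob]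
  · simp only [if_neg h, sub_zero]
    rw [← mul_pow, frob_smul, norm_prod]
    refine pow_le_pow_left₀ (mul_nonneg (by positivity) (frob_nonneg _)) ?_ 2
    exact mul_le_mul_of_nonneg_right
      (Finset.prod_le_prod (fun _ _ => norm_nonneg _) fun j _ => norm_le_maxOffDiag (G j) h)
      (frob_nonneg _)

end Dephasing

/-- multi-time equilibration bound, Theorem 1: for Hermitian `ϱ` with
equilibrium `ϖ = 𝒟(ϱ)`, linear maps `𝒜₀,…,𝒜_k`, partial dephasings `𝒢_j = 𝒢_{G⁽ʲ⁾}` with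
unit-diagonal coefficient families `G⁽ʲ⁾`, intermediate states
`ϱ_ℓ = 𝒢_ℓ 𝒜_{ℓ−1} ⋯ 𝒜₀ 𝒢₀ (ϱ)` and `ϖ_ℓ = 𝒟 𝒜_{ℓ−1} ⋯ 𝒜₀ 𝒟 (ϱ)`,
`|tr[((𝒜_k𝒢_k)⋯(𝒜₀𝒢₀))(ϱ)] − tr[((𝒜_k𝒟)⋯(𝒜₀𝒟))(ϱ)]| ≤
ν(𝒜_{k:0}) 𝔖_{k:0} ‖ϱ − ϖ‖₂ +
Σ_{ℓ=0}^{k−1} ν(𝒜_{k:ℓ+1}) (‖[𝒢_{k:ℓ+1} − 𝒟, 𝒜_ℓ](ϱ_ℓ)‖₂ + ‖[𝒟, 𝒜_ℓ](ϱ_ℓ − ϖ_ℓ)‖₂)`,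
where `𝔖_{b:a} = ∏_{j=a}^{b} max_{n≠m} |G⁽ʲ⁾_{nm}|`. -/
theorem multitime_equilibration_bound {d : ℕ} {ι : Type*}
    [Fintype ι] [DecidableEq ι] [Nontrivial ι]
    (P : ι → Matrix (Fin d) (Fin d) ℂ)
    (hHerm : ∀ n, (P n)ᴴ = P n)
    (hOrth : ∀ n m, n ≠ m → P n * P m = 0)
    (hIdem : ∀ n, P n * P n = P n)
    (hSum : ∑ n, P n = 1)
    (ϱ : Matrix (Fin d) (Fin d) ℂ) (hϱ : ϱᴴ = ϱ)
    (k : ℕ)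
    (A : ℕ → Module.End ℂ (Matrix (Fin d) (Fin d) ℂ))
    (G : ℕ → ι → ι → ℂ)
    (hG : ∀ j, j ≤ k → ∀ n, G j n n = 1) :
    ‖(chainApply (fun j X => A j (pdeph P (G j) X)) (k + 1) ϱ).trace -
        (chainApply (fun j X => A j (deph P X)) (k + 1) ϱ).trace‖ ≤
      nuFrob (chainEnd A 0 (k + 1)) * (∏ j ∈ Finset.Icc 0 k, maxOffDiag (G j)) *
          frob (ϱ - deph P ϱ) +
        ∑ ℓ ∈ Finset.range k,
          nuFrob (chainEnd A (ℓ + 1) (k - ℓ)) *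
            (frob
                ((chainFun (fun j => pdeph P (G j)) (ℓ + 1) (k - ℓ)
                      (A ℓ (pdeph P (G ℓ)
                        (chainApply (fun j X => A j (pdeph P (G j) X)) ℓ ϱ))) -
                    deph P (A ℓ (pdeph P (G ℓ)
                      (chainApply (fun j X => A j (pdeph P (G j) X)) ℓ ϱ)))) -
                  A ℓ
                    (chainFun (fun j => pdeph P (G j)) (ℓ + 1) (k - ℓ)
                        (pdeph P (G ℓ)
                          (chainApply (fun j X => A j (pdeph P (G j) X)) ℓ ϱ)) -
                      deph P (pdeph P (G ℓ)
                        (chainApply (fun j X => A j (pdeph P (G j) X)) ℓ ϱ)))) +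
              frob
                (deph P (A ℓ
                      (pdeph P (G ℓ) (chainApply (fun j X => A j (pdeph P (G j) X)) ℓ ϱ) -
                        deph P (chainApply (fun j X => A j (deph P X)) ℓ ϱ))) -
                  A ℓ (deph P
                      (pdeph P (G ℓ) (chainApply (fun j X => A j (pdeph P (G j) X)) ℓ ϱ) -
                        deph P (chainApply (fun j X => A j (deph P X)) ℓ ϱ))))) := by
  set r : ℕ → Matrix (Fin d) (Fin d) ℂ := fun l =>
    pdeph P (G l) (chainApply (fun j X => A j (pdeph P (G j) X)) l ϱ) with hr
  set w : ℕ → Matrix (Fin d) (Fin d) ℂ := fun l =>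
    deph P (chainApply (fun j X => A j (deph P X)) l ϱ) with hw
  set K : ℕ → Matrix (Fin d) (Fin d) ℂ → Matrix (Fin d) (Fin d) ℂ := fun l =>
    chainFun (fun j => pdeph P (G j)) (l + 1) (k - l) with hK
  set C₁ : ℕ → Matrix (Fin d) (Fin d) ℂ := fun l =>
    (K l (A l (r l)) - deph P (A l (r l))) - A l (K l (r l) - deph P (r l)) with hC₁
  set C₂ : ℕ → Matrix (Fin d) (Fin d) ℂ := fun l =>
    deph P (A l (r l - w l)) - A l (deph P (r l - w l)) with hC₂
  change ‖(A k (r k)).trace - (A k (w k)).trace‖ ≤ _ + ∑ l ∈ Finset.range k,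
    nuFrob (chainEnd A (l + 1) (k - l)) * (frob (C₁ l) + frob (C₂ l))
  have hstep : ∀ l < k, K (l + 1) (r (l + 1)) - w (l + 1) =
      A l (K l (r l) - w l) + (C₁ l + C₂ l) := fun l hl => by
    have hKr : K (l + 1) (r (l + 1)) = K l (A l (r l)) := by
      simp only [hK, show k - l = k - (l + 1) + 1 by omega, chainFun_succ']
      rfl
    have hww : w (l + 1) = deph P (A l (w l)) := rfl
    have hdw : deph P (w l) = w l := deph_deph hOrth hIdem _
    simp only [hKr, hww, hC₁, hC₂, deph_sub, map_sub, hdw]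
    abel
  have hinit : K 0 (r 0) = chainFun (fun j => pdeph P (G j)) 0 (k + 1) ϱ :=
    (chainFun_succ' _ 0 k ϱ).symm
  have htel := chainEnd_eq_add_sum A (fun l => K l (r l) - w l) (fun l => C₁ l + C₂ l) k
    hstep k le_rfl
  have hfinal : chainEnd A k (k + 1 - k) (K k (r k) - w k) = A k (r k) - A k (w k) := by
    simp [hK, chainFun, chainEnd]
  rw [hfinal] at htel
  rw [← trace_sub, htel, trace_add, trace_sum]
  refine norm_add_le_of_le ?_ (norm_sum_le_of_le _ fun l _ => ?_)
  · refine (norm_trace_le_nuFrob_mul_frob _ _).trans ?_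
    rw [mul_assoc, hinit, ← Nat.range_succ_eq_Icc_zero]
    exact mul_le_mul_of_nonneg_left (frob_chainFun_pdeph_sub_deph_le hHerm hOrth hIdem hSum G
      (k + 1) (fun j hj => hG j (Nat.lt_succ_iff.mp hj)) ϱ) (nuFrob_nonneg _)
  · rw [map_add, trace_add, mul_add]
    exact norm_add_le_of_le (norm_trace_le_nuFrob_mul_frob _ _)
      (norm_trace_le_nuFrob_mul_frob _ _)
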